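/- Let (A,·) be an anti-flexible algebra and N : A → A a Nijenhuis operator, and let k, l be natural numbers. Then N^l is an algebra homomorphism from (A, ·_{N^{k+l}}) to (A, ·_{N^k}), i.e. N^l(a ·_{N^{k+l}} b) = N^l(a) ·_{N^k} N^l(b) for all a, b ∈ A. -/

import Mathlib

/-- The anti-flexible identity for a (bilinear) product. -/
def AntiFlexible {A : Type*} [AddCommGroup A] (mul : A → A → A) : Prop :=
  ∀ a b c : A, mul (mul a b) c - mul a (mul b c) = mul (mul c b) a - mul c (mul b a)

/-- Nijenhuis operator on `(A, mul)`. -/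
def IsNijenhuis {A : Type*} [AddCommGroup A] (mul : A → A → A) (N : A → A) : Prop :=
  ∀ a b : A, mul (N a) (N b) = N (mul (N a) b + mul a (N b) - N (mul a b))

/-- The product deformed by a map `P`: `a ·_P b = P(a)·b + a·P(b) − P(a·b)`. -/
def deformMul {A : Type*} [AddCommGroup A] (mul : A → A → A) (P : A → A) : A → A → A :=
  fun a b => mul (P a) b + mul a (P b) - P (mul a b)

section

variable {K A : Type*} [Field K] [AddCommGroup A] [Module K A]
  {mul : A →ₗ[K] A →ₗ[K] A} {N : Module.End K A}

theorem IsNijenhuis.mul_apply_pow (hN : IsNijenhuis (fun a b => mul a b) N) (j : ℕ) (a b : A) :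
    mul (N a) ((N ^ j) b) =
      (N ^ j) (mul (N a) b) + N (mul a ((N ^ j) b)) - (N ^ (j + 1)) (mul a b) := by
  induction j with
  | zero => simp
  | succ j ih =>
    have h := hN a ((N ^ j) b)
    simp only [map_add, map_sub, ih] at h
    simp only [pow_succ', Module.End.mul_apply] at h ⊢
    rw [h]
    abel

theorem IsNijenhuis.pow_mul_pow (hN : IsNijenhuis (fun a b => mul a b) N) (i j : ℕ) (a b : A) :
    mul ((N ^ i) a) ((N ^ j) b) =
      (N ^ j) (mul ((N ^ i) a) b) + (N ^ i) (mul a ((N ^ j) b)) -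
        (N ^ (i + j)) (mul a b) := by
  induction i generalizing a with
  | zero => simp
  | succ i ih =>
    rw [pow_succ, Module.End.mul_apply, ih, hN.mul_apply_pow, map_sub, map_add]
    have h₁ (x : A) : (N ^ i) ((N ^ j) x) = (N ^ (i + j)) x := by
      rw [pow_add, Module.End.mul_apply]
    have h₂ (x : A) : (N ^ i) ((N ^ (j + 1)) x) = (N ^ (i + 1 + j)) x := by
      rw [← Module.End.mul_apply, ← pow_add, add_right_comm, add_assoc]
    rw [h₁, h₂, Module.End.mul_apply]
    abel

end

/-- if `N` is a Nijenhuis operator on an anti-flexible algebra `(A, ·)`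
then `N^l` is an algebra homomorphism from `(A, ·_{N^{k+l}})` to `(A, ·_{N^k})`. -/
theorem nijenhuis_power_hom {K A : Type*} [Field K]
    [AddCommGroup A] [Module K A]
    (mul : A →ₗ[K] A →ₗ[K] A) (hA : AntiFlexible fun a b => mul a b)
    (N : Module.End K A) (hN : IsNijenhuis (fun a b => mul a b) N)
    (k l : ℕ) :
    ∀ a b : A,
      (N ^ l) (deformMul (fun a b => mul a b) ⇑(N ^ (k + l)) a b) =
        deformMul (fun a b => mul a b) ⇑(N ^ k) ((N ^ l) a) ((N ^ l) b) := by
  intro a b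
  have h (i j : ℕ) (x : A) : (N ^ i) ((N ^ j) x) = (N ^ (i + j)) x := by
    rw [pow_add, Module.End.mul_apply]
  simp only [deformMul, map_add, map_sub, h]
  rw [hN.pow_mul_pow (k + l) l, hN.pow_mul_pow l (k + l), hN.pow_mul_pow l l]
  simp only [map_add, map_sub, h]
  rw [add_comm (k + l) l, show k + (l + l) = l + (k + l) by ring]
  abel
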